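/- arXiv:0812.1351 — 6 statements merged into one kernel-verified Lean document; each statement's English description precedes it below -/
import Mathlib

section
/- Let a, c : ℝ → ℝ and b, e : ℝ × ℝ → ℝ be smooth functions. Define vector fields on ℝ⁴ (with coordinates (x,u,u₁,f)) by X̂_{a,b}(x,u,u₁,f) = (a(x), b(x,u), u₁·b_u(x,u) + f·b_x(x,u), a'(x)·f) and similarly for X̂_{c,e}. Then [X̂_{a,b}, X̂_{c,e}] = X̂_{A,B}, where A(x) = a(x)·c'(x) − c(x)·a'(x) and B(x,u) = a(x)·e_x(x,u) + b(x,u)·e_u(x,u) − c(x)·b_x(x,u) − e(x,u)·b_u(x,u). That is, the lift X_{a,b} ↦ X̂_{a,b} is a homomorphism from the Lie algebra of feedback vector fields on ℝ² to the Lie algebra of smooth vector fields on ℝ⁴. -/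
noncomputable section

/-- The lift `X̂_{a,b}` of the feedback vector field `X_{a,b} = a ∂x + b ∂u` to
`ℝ⁴` with coordinates `(x, u, u₁, f)`:
`X̂_{a,b} = a ∂x + b ∂u + (u₁ b_u + f b_x) ∂u₁ + a'(x) f ∂f`. -/
def lift (a : ℝ → ℝ) (b : ℝ × ℝ → ℝ) : ℝ × ℝ × ℝ × ℝ → ℝ × ℝ × ℝ × ℝ :=
  fun p =>
    (a p.1, b (p.1, p.2.1),
      p.2.2.1 * fderiv ℝ b (p.1, p.2.1) (0, 1) + p.2.2.2 * fderiv ℝ b (p.1, p.2.1) (1, 0),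
      deriv a p.1 * p.2.2.2)

theorem apply_prod_eq {F : Type*} [NormedAddCommGroup F] [NormedSpace ℝ F]
    (L : ℝ × ℝ →L[ℝ] F) (s t : ℝ) : L (s, t) = s • L (1, 0) + t • L (0, 1) := by
  rw [← map_smul, ← map_smul, ← map_add]
  simp

theorem ContDiff.differentiable_deriv_of_smooth {a : ℝ → ℝ} (ha : ContDiff ℝ (⊤ : ℕ∞) a) :
    Differentiable ℝ (deriv a) :=
  (contDiff_infty_iff_deriv.1 ha).2.differentiable (by simp)

theorem ContDiff.hasFDerivAt_fderiv_apply {E F : Type*} [NormedAddCommGroup E] [NormedSpace ℝ E]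
    [NormedAddCommGroup F] [NormedSpace ℝ F] {b : E → F} (hb : ContDiff ℝ (⊤ : ℕ∞) b) (q v : E) :
    HasFDerivAt (fun y => fderiv ℝ b y v) ((fderiv ℝ (fderiv ℝ b) q).flip v) q := by
  have h : Differentiable ℝ (fderiv ℝ b) :=
    ((contDiff_infty.1 hb 2).fderiv_right (m := 1) one_add_one_eq_two.le).differentiable (by simp)
  exact (ContinuousLinearMap.apply ℝ F v).hasFDerivAt.comp q (h q).hasFDerivAt

theorem ContDiff.fderiv_fderiv_comm {E F : Type*} [NormedAddCommGroup E] [NormedSpace ℝ E]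
    [NormedAddCommGroup F] [NormedSpace ℝ F] {b : E → F} (hb : ContDiff ℝ (⊤ : ℕ∞) b)
    (q v w : E) : fderiv ℝ (fderiv ℝ b) q v w = fderiv ℝ (fderiv ℝ b) q w v :=
  ((contDiff_infty.1 hb 2).contDiffAt.isSymmSndFDerivAt (by simp)) v w

/-- The derivative of the lift of a smooth feedback vector field. -/
theorem fderiv_lift_apply {a : ℝ → ℝ} {b : ℝ × ℝ → ℝ} (ha : ContDiff ℝ (⊤ : ℕ∞) a)
    (hb : ContDiff ℝ (⊤ : ℕ∞) b) (p v : ℝ × ℝ × ℝ × ℝ) :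
    fderiv ℝ (lift a b) p v =
      (deriv a p.1 * v.1, fderiv ℝ b (p.1, p.2.1) (v.1, v.2.1),
        v.2.2.1 * fderiv ℝ b (p.1, p.2.1) (0, 1)
          + p.2.2.1 * fderiv ℝ (fderiv ℝ b) (p.1, p.2.1) (v.1, v.2.1) (0, 1)
          + v.2.2.2 * fderiv ℝ b (p.1, p.2.1) (1, 0)
          + p.2.2.2 * fderiv ℝ (fderiv ℝ b) (p.1, p.2.1) (v.1, v.2.1) (1, 0),
        deriv (deriv a) p.1 * v.1 * p.2.2.2 + deriv a p.1 * v.2.2.2) := by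
  have hx : HasFDerivAt (fun p : ℝ × ℝ × ℝ × ℝ => p.1)
      (ContinuousLinearMap.fst ℝ ℝ (ℝ × ℝ × ℝ)) p := hasFDerivAt_fst
  have hsnd : HasFDerivAt (fun p : ℝ × ℝ × ℝ × ℝ => p.2)
      (ContinuousLinearMap.snd ℝ ℝ (ℝ × ℝ × ℝ)) p := hasFDerivAt_snd
  have hu := hsnd.fst
  have hu₁ := hsnd.snd.fst
  have hf := hsnd.snd.snd
  have hq := hx.prodMk hu
  have ha₁ := ((ha.differentiable (by simp)) p.1).hasDerivAt.comp_hasFDerivAt p hx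
  have ha₂ := (ha.differentiable_deriv_of_smooth p.1).hasDerivAt.comp_hasFDerivAt p hx
  have hb₁ := (hb.differentiable (by simp) (p.1, p.2.1)).hasFDerivAt.comp p hq
  have hbu := (hb.hasFDerivAt_fderiv_apply (p.1, p.2.1) (0, 1)).comp p hq
  have hbx := (hb.hasFDerivAt_fderiv_apply (p.1, p.2.1) (1, 0)).comp p hq
  have h := ha₁.prodMk (hb₁.prodMk (((hu₁.mul hbu).add (hf.mul hbx)).prodMk (ha₂.mul hf)))
  refine (congrArg (fun L : (ℝ × ℝ × ℝ × ℝ) →L[ℝ] (ℝ × ℝ × ℝ × ℝ) => L v) h.fderiv).trans ?_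
  simp
  constructor <;> ring

/-- `[X̂_{a,b}, X̂_{c,e}] = X̂_{A,B}` where
`A x = a x * c' x - c x * a' x` and `B = a e_x + b e_u - c b_x - e b_u`;
i.e. the lift `X_{a,b} ↦ X̂_{a,b}` is a Lie algebra homomorphism.
The Lie bracket of vector fields is `[V,W](p) = DW(p)·V(p) - DV(p)·W(p)`. -/
theorem lift_is_lie_algebra_hom
    (a c : ℝ → ℝ) (b e : ℝ × ℝ → ℝ)
    (ha : ContDiff ℝ (⊤ : ℕ∞) a) (hc : ContDiff ℝ (⊤ : ℕ∞) c)
    (hb : ContDiff ℝ (⊤ : ℕ∞) b) (he : ContDiff ℝ (⊤ : ℕ∞) e) :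
    ∀ p : ℝ × ℝ × ℝ × ℝ,
      fderiv ℝ (lift c e) p (lift a b p) - fderiv ℝ (lift a b) p (lift c e p)
        = lift (fun x : ℝ => a x * deriv c x - c x * deriv a x)
            (fun q : ℝ × ℝ =>
              a q.1 * fderiv ℝ e q (1, 0) + b q * fderiv ℝ e q (0, 1)
                - c q.1 * fderiv ℝ b q (1, 0) - e q * fderiv ℝ b q (0, 1)) p := by
  intro p
  have ha' : Differentiable ℝ a := ha.differentiable (by simp)
  have hc' : Differentiable ℝ c := hc.differentiable (by simp)
  have ha'' : Differentiable ℝ (deriv a) := ha.differentiable_deriv_of_smooth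
  have hc'' : Differentiable ℝ (deriv c) := hc.differentiable_deriv_of_smooth
  have hA : deriv (fun x : ℝ => a x * deriv c x - c x * deriv a x) p.1
      = a p.1 * deriv (deriv c) p.1 - c p.1 * deriv (deriv a) p.1 := by
    have h := (((ha' p.1).hasDerivAt.mul (hc'' p.1).hasDerivAt).sub
      ((hc' p.1).hasDerivAt.mul (ha'' p.1).hasDerivAt)).deriv
    refine h.trans ?_
    ring
  have hB : ∀ w : ℝ × ℝ, fderiv ℝ (fun q : ℝ × ℝ =>
      a q.1 * fderiv ℝ e q (1, 0) + b q * fderiv ℝ e q (0, 1)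
        - c q.1 * fderiv ℝ b q (1, 0) - e q * fderiv ℝ b q (0, 1)) (p.1, p.2.1) w
      = deriv a p.1 * w.1 * fderiv ℝ e (p.1, p.2.1) (1, 0)
        + a p.1 * fderiv ℝ (fderiv ℝ e) (p.1, p.2.1) w (1, 0)
        + fderiv ℝ b (p.1, p.2.1) w * fderiv ℝ e (p.1, p.2.1) (0, 1)
        + b (p.1, p.2.1) * fderiv ℝ (fderiv ℝ e) (p.1, p.2.1) w (0, 1)
        - (deriv c p.1 * w.1 * fderiv ℝ b (p.1, p.2.1) (1, 0)
          + c p.1 * fderiv ℝ (fderiv ℝ b) (p.1, p.2.1) w (1, 0))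
        - (fderiv ℝ e (p.1, p.2.1) w * fderiv ℝ b (p.1, p.2.1) (0, 1)
          + e (p.1, p.2.1) * fderiv ℝ (fderiv ℝ b) (p.1, p.2.1) w (0, 1)) := by
    intro w
    have hfst : HasFDerivAt (fun q : ℝ × ℝ => q.1) (ContinuousLinearMap.fst ℝ ℝ ℝ)
        (p.1, p.2.1) := hasFDerivAt_fst
    have ha₁ := (ha' p.1).hasDerivAt.comp_hasFDerivAt (p.1, p.2.1) hfst
    have hc₁ := (hc' p.1).hasDerivAt.comp_hasFDerivAt (p.1, p.2.1) hfst
    have hb₁ := (hb.differentiable (by simp) (p.1, p.2.1)).hasFDerivAt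
    have he₁ := (he.differentiable (by simp) (p.1, p.2.1)).hasFDerivAt
    have h := (((ha₁.mul (he.hasFDerivAt_fderiv_apply _ (1, 0))).add
      (hb₁.mul (he.hasFDerivAt_fderiv_apply _ (0, 1)))).sub
      (hc₁.mul (hb.hasFDerivAt_fderiv_apply _ (1, 0)))).sub
      (he₁.mul (hb.hasFDerivAt_fderiv_apply _ (0, 1)))
    refine (congrArg (fun L : ℝ × ℝ →L[ℝ] ℝ => L w) h.fderiv).trans ?_
    simp
    ring
  have hsb := hb.fderiv_fderiv_comm (p.1, p.2.1) (1, 0) (0, 1)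
  have hse := he.fderiv_fderiv_comm (p.1, p.2.1) (1, 0) (0, 1)
  rw [fderiv_lift_apply ha hb, fderiv_lift_apply hc he]
  simp only [lift, hA, hB, Prod.mk_sub_mk, Prod.mk.injEq]
  refine ⟨by ring, ?_, ?_, by ring⟩
  · rw [apply_prod_eq (fderiv ℝ e _) (a p.1), apply_prod_eq (fderiv ℝ b _) (c p.1)]
    ring
  · rw [apply_prod_eq (fderiv ℝ (fderiv ℝ e) _) (a p.1),
      apply_prod_eq (fderiv ℝ (fderiv ℝ b) _) (c p.1)]
    simp only [add_apply, smul_apply, smul_eq_mul,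
      hsb, hse]
    ring
end
end

section
/- Let F, G : ℝ³ → ℝ be smooth and suppose the feedback transformation (X,U) relates G to F on an open set D ⊆ ℝ³. Let p = (x,u,u₁) ∈ D with W(p) ≠ 0. Then: (i) F(Φ̃(p)) = 0 if and only if G(p) = 0; (ii) F_{u₁}(Φ̃(p)) = 0 if and only if G_{u₁}(p) = 0; (iii) F_{u₁u₁}(Φ̃(p)) = 0 if and only if G_{u₁u₁}(p) = 0. In particular, the singular sets {f = 0}, {f_{u₁} = 0}, {f_{u₁u₁} = 0} are preserved by feedback transformations, and regularity of a point is a feedback-invariant property. -/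
noncomputable section

/-- Directional (partial) derivative of a function on `ℝ³ = ℝ × ℝ × ℝ`
(coordinates `(x, u, u₁)`) in the direction `v`. -/
def pd (H : ℝ × ℝ × ℝ → ℝ) (v : ℝ × ℝ × ℝ) : ℝ × ℝ × ℝ → ℝ :=
  fun p => fderiv ℝ H p v

/-- The coordinate direction `∂/∂x`. -/
def dx : ℝ × ℝ × ℝ := (1, 0, 0)

/-- The coordinate direction `∂/∂u`. -/
def du : ℝ × ℝ × ℝ := (0, 1, 0)

/-- The coordinate direction `∂/∂u₁`. -/
def du1 : ℝ × ℝ × ℝ := (0, 0, 1)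

/-- `U_x`, the partial derivative of `U(x,u)` in the first variable. -/
def Ux (U : ℝ × ℝ → ℝ) : ℝ × ℝ → ℝ := fun q => fderiv ℝ U q (1, 0)

/-- `U_u`, the partial derivative of `U(x,u)` in the second variable. -/
def Uu (U : ℝ × ℝ → ℝ) : ℝ × ℝ → ℝ := fun q => fderiv ℝ U q (0, 1)

/-- The feedback transformation `(X, U)` relates `G` to `F` on `D`:
`X'(x)·G(x,u,u₁) = F(X x, U (x,u), U_x·G + U_u·u₁)` for all `(x,u,u₁) ∈ D`. -/
def Relates (X : ℝ → ℝ) (U : ℝ × ℝ → ℝ) (G F : ℝ × ℝ × ℝ → ℝ) (D : Set (ℝ × ℝ × ℝ)) : Prop :=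
  ∀ p ∈ D, deriv X p.1 * G p =
    F (X p.1, U (p.1, p.2.1), Ux U (p.1, p.2.1) * G p + Uu U (p.1, p.2.1) * p.2.2)

/-- The prolongation `Φ̃(x,u,u₁) = (X x, U (x,u), U_x·G + U_u·u₁)`. -/
def Prol (X : ℝ → ℝ) (U : ℝ × ℝ → ℝ) (G : ℝ × ℝ × ℝ → ℝ) : ℝ × ℝ × ℝ → ℝ × ℝ × ℝ :=
  fun p => (X p.1, U (p.1, p.2.1), Ux U (p.1, p.2.1) * G p + Uu U (p.1, p.2.1) * p.2.2)

/-- `W(x,u,u₁) = U_x(x,u)·G_{u₁}(x,u,u₁) + U_u(x,u)`. -/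
def Wfun (U : ℝ × ℝ → ℝ) (G : ℝ × ℝ × ℝ → ℝ) : ℝ × ℝ × ℝ → ℝ :=
  fun p => Ux U (p.1, p.2.1) * pd G du1 p + Uu U (p.1, p.2.1)

/-- The restriction of a differentiable `H` to a line parallel to the `u₁`-axis has derivative
`H_{u₁}`. -/
theorem hasDerivAt_slice {H : ℝ × ℝ × ℝ → ℝ} (hH : Differentiable ℝ H) (x u s : ℝ) :
    HasDerivAt (fun t => H (x, u, t)) (pd H du1 (x, u, s)) s := by
  have hl : HasDerivAt (fun t : ℝ => ((x, u, t) : ℝ × ℝ × ℝ)) du1 s :=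
    (hasDerivAt_const s x).prodMk ((hasDerivAt_const s u).prodMk (hasDerivAt_id s))
  exact (hH (x, u, s)).hasFDerivAt.comp_hasDerivAt s hl

/-- Directional derivatives of a smooth function are differentiable. -/
theorem differentiable_pd {H : ℝ × ℝ × ℝ → ℝ} (hH : ContDiff ℝ (⊤ : ℕ∞) H) (v : ℝ × ℝ × ℝ) :
    Differentiable ℝ (pd H v) := by
  have h : ContDiff ℝ 1 (fderiv ℝ H) := hH.fderiv_right (by norm_cast)
  exact (h.differentiable one_ne_zero).clm_apply (differentiable_const v)

/-- The last component of the prolongation has `u₁`-derivative `W`. -/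
theorem hasDerivAt_prol_snd_snd (U : ℝ × ℝ → ℝ) {G : ℝ × ℝ × ℝ → ℝ} (hG : Differentiable ℝ G)
    (x u s : ℝ) :
    HasDerivAt (fun t => Ux U (x, u) * G (x, u, t) + Uu U (x, u) * t)
      (Wfun U G (x, u, s)) s := by
  have h := ((hasDerivAt_slice hG x u s).const_mul (Ux U (x, u))).add
    ((hasDerivAt_id s).const_mul (Uu U (x, u)))
  rw [mul_one] at h
  exact h

/-- Differentiating the feedback relation in `u₁`: `X' G_{u₁} = F_{u₁}(Φ̃) W`. -/
theorem Relates.deriv_mul_pd {X : ℝ → ℝ} {U : ℝ × ℝ → ℝ} {F G : ℝ × ℝ × ℝ → ℝ}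
    {D : Set (ℝ × ℝ × ℝ)} (hrel : Relates X U G F D) (hD : IsOpen D)
    (hF : Differentiable ℝ F) (hG : Differentiable ℝ G) {p : ℝ × ℝ × ℝ} (hp : p ∈ D) :
    deriv X p.1 * pd G du1 p = pd F du1 (Prol X U G p) * Wfun U G p := by
  obtain ⟨x, u, s⟩ := p
  have hg := hasDerivAt_slice hG x u s
  have hinner := hasDerivAt_prol_snd_snd U hG x u s
  have hcomp := (hasDerivAt_slice hF (X x) (U (x, u))
    (Ux U (x, u) * G (x, u, s) + Uu U (x, u) * s)).comp s hinner
  have hev : ∀ᶠ t in nhds s, (x, u, t) ∈ D :=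
    (show Continuous fun t : ℝ => (x, u, t) by fun_prop).continuousAt.eventually (hD.mem_nhds hp)
  exact (hg.const_mul (deriv X x)).unique
    (hcomp.congr_of_eventuallyEq (hev.mono fun t ht => hrel _ ht))

/-- Differentiating the feedback relation twice in `u₁`. -/
theorem Relates.deriv_mul_pd_pd {X : ℝ → ℝ} {U : ℝ × ℝ → ℝ} {F G : ℝ × ℝ × ℝ → ℝ}
    {D : Set (ℝ × ℝ × ℝ)} (hrel : Relates X U G F D) (hD : IsOpen D)
    (hF : ContDiff ℝ (⊤ : ℕ∞) F) (hG : ContDiff ℝ (⊤ : ℕ∞) G) {p : ℝ × ℝ × ℝ} (hp : p ∈ D) :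
    deriv X p.1 * pd (pd G du1) du1 p =
      pd (pd F du1) du1 (Prol X U G p) * Wfun U G p * Wfun U G p +
        pd F du1 (Prol X U G p) * (Ux U (p.1, p.2.1) * pd (pd G du1) du1 p) := by
  obtain ⟨x, u, s⟩ := p
  have hF1 : Differentiable ℝ F := hF.differentiable (by simp)
  have hG1 : Differentiable ℝ G := hG.differentiable (by simp)
  have hgg := hasDerivAt_slice (differentiable_pd hG du1) x u s
  have hinner := hasDerivAt_prol_snd_snd U hG1 x u s
  have hcomp := (hasDerivAt_slice (differentiable_pd hF du1) (X x) (U (x, u))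
    (Ux U (x, u) * G (x, u, s) + Uu U (x, u) * s)).comp s hinner
  have hW : HasDerivAt (fun t => Wfun U G (x, u, t))
      (Ux U (x, u) * pd (pd G du1) du1 (x, u, s)) s :=
    (hgg.const_mul (Ux U (x, u))).add_const (Uu U (x, u))
  have hev : ∀ᶠ t in nhds s, (x, u, t) ∈ D :=
    (show Continuous fun t : ℝ => (x, u, t) by fun_prop).continuousAt.eventually (hD.mem_nhds hp)
  exact (hgg.const_mul (deriv X x)).unique
    ((hcomp.mul hW).congr_of_eventuallyEq
      (hev.mono fun t ht => hrel.deriv_mul_pd hD hF1 hG1 ht))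

/-- if `(X,U)` relates `G` to `F` on an open set `D` and `W(p) ≠ 0`
at `p ∈ D`, then the vanishing of `F`, `F_{u₁}`, `F_{u₁u₁}` at `Φ̃(p)` is
equivalent to the vanishing of `G`, `G_{u₁}`, `G_{u₁u₁}` at `p`; hence the
singular sets `{f = 0}`, `{f_{u₁} = 0}`, `{f_{u₁u₁} = 0}` are preserved and
regularity of a point is a feedback-invariant property. -/
theorem singular_sets_feedback_invariant
    (F G : ℝ × ℝ × ℝ → ℝ) (X : ℝ → ℝ) (U : ℝ × ℝ → ℝ)
    (hF : ContDiff ℝ (⊤ : ℕ∞) F) (hG : ContDiff ℝ (⊤ : ℕ∞) G)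
    (hX : ContDiff ℝ (⊤ : ℕ∞) X) (hU : ContDiff ℝ (⊤ : ℕ∞) U)
    (hX' : ∀ x, deriv X x ≠ 0) (hUu : ∀ q, Uu U q ≠ 0)
    (D : Set (ℝ × ℝ × ℝ)) (hD : IsOpen D)
    (hrel : Relates X U G F D)
    (p : ℝ × ℝ × ℝ) (hp : p ∈ D) (hW : Wfun U G p ≠ 0) :
    (F (Prol X U G p) = 0 ↔ G p = 0) ∧
    (pd F du1 (Prol X U G p) = 0 ↔ pd G du1 p = 0) ∧
    (pd (pd F du1) du1 (Prol X U G p) = 0 ↔ pd (pd G du1) du1 p = 0) := by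
  have hc := hX' p.1
  have hb := hUu (p.1, p.2.1)
  have h0 : deriv X p.1 * G p = F (Prol X U G p) := hrel p hp
  have h1 := hrel.deriv_mul_pd hD (hF.differentiable (by simp)) (hG.differentiable (by simp)) hp
  have h2 := hrel.deriv_mul_pd_pd hD hF hG hp
  refine ⟨by simp [← h0, hc], ?_, ?_⟩
  · rw [← mul_eq_zero_iff_right hW, ← h1, mul_eq_zero_iff_left hc]
  · have hWdef : Wfun U G p = Ux U (p.1, p.2.1) * pd G du1 p + Uu U (p.1, p.2.1) := rfl
    have key : pd (pd F du1) du1 (Prol X U G p) * Wfun U G p ^ 3 =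
        deriv X p.1 * Uu U (p.1, p.2.1) * pd (pd G du1) du1 p := by
      linear_combination (-Wfun U G p) * h2 +
        Ux U (p.1, p.2.1) * pd (pd G du1) du1 p * h1 +
        deriv X p.1 * pd (pd G du1) du1 p * hWdef
    rw [← mul_eq_zero_iff_right (pow_ne_zero 3 hW), key,
      mul_eq_zero_iff_left (mul_ne_zero hc hb)]
end
end

section
/- Let F, G : ℝ³ → ℝ be smooth and suppose the feedback transformation (X,U) relates G to F on an open set D ⊆ ℝ³. For p = (x,u,u₁) ∈ D, write v(p) = U_x(x,u)·G(p) + U_u(x,u)·u₁ for the third component of Φ̃(p). Then for every p ∈ D, the transformation law (v(p)·F_{u₁}(Φ̃(p)) − F(Φ̃(p)))·W(p) = X'(x)·U_u(x,u)·(u₁·G_{u₁}(p) − G(p)) holds. In particular, where X'(x) ≠ 0, U_u ≠ 0 and W(p) ≠ 0, the condition u₁·G_{u₁} − G ≠ 0 is feedback-invariant. -/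
noncomputable section

/-- The restriction of `H` to a line parallel to the `u₁`-axis has derivative `H_{u₁}`. -/
theorem hasDerivAt_third_variable {H : ℝ × ℝ × ℝ → ℝ} {a b t : ℝ}
    (hH : DifferentiableAt ℝ H (a, b, t)) :
    HasDerivAt (fun s => H (a, b, s)) (pd H du1 (a, b, t)) t := by
  have hline : HasDerivAt (fun s : ℝ => ((a, b, s) : ℝ × ℝ × ℝ)) du1 t :=
    (hasDerivAt_const t a).prodMk ((hasDerivAt_const t b).prodMk (hasDerivAt_id t))
  exact hH.hasFDerivAt.comp_hasDerivAt t hline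

/-- Differentiating the relation in `u₁`: `F_{u₁}(Φ̃(p))·W(p) = X'(x)·G_{u₁}(p)`. -/
theorem Relates.pd_du1_mul_Wfun {F G : ℝ × ℝ × ℝ → ℝ} {X : ℝ → ℝ} {U : ℝ × ℝ → ℝ}
    {D : Set (ℝ × ℝ × ℝ)} (hrel : Relates X U G F D) (hF : Differentiable ℝ F)
    (hG : Differentiable ℝ G) (hD : IsOpen D) {p : ℝ × ℝ × ℝ} (hp : p ∈ D) :
    pd F du1 (Prol X U G p) * Wfun U G p = deriv X p.1 * pd G du1 p := by
  obtain ⟨x, u, t⟩ := p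
  have hGt : HasDerivAt (fun s => G (x, u, s)) (pd G du1 (x, u, t)) t :=
    hasDerivAt_third_variable (hG _)
  have hv : HasDerivAt (fun s => Ux U (x, u) * G (x, u, s) + Uu U (x, u) * s)
      (Wfun U G (x, u, t)) t := by
    simpa [Wfun] using
      (hGt.const_mul (Ux U (x, u))).fun_add ((hasDerivAt_id t).const_mul (Uu U (x, u)))
  have hFt : HasDerivAt
      (fun s => F (X x, U (x, u), Ux U (x, u) * G (x, u, s) + Uu U (x, u) * s))
      (pd F du1 (Prol X U G (x, u, t)) * Wfun U G (x, u, t)) t :=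
    HasDerivAt.comp t (hasDerivAt_third_variable (hF _)) hv
  have hmem : ∀ᶠ s in nhds t, (x, u, s) ∈ D :=
    (show Continuous fun s : ℝ => ((x, u, s) : ℝ × ℝ × ℝ) by fun_prop).continuousAt.eventually
      (hD.mem_nhds hp)
  have hfun : (fun s => deriv X x * G (x, u, s)) =ᶠ[nhds t]
      fun s => F (X x, U (x, u), Ux U (x, u) * G (x, u, s) + Uu U (x, u) * s) :=
    hmem.mono fun s hs => hrel _ hs
  exact (hFt.congr_of_eventuallyEq hfun).unique (hGt.const_mul (deriv X x))

/-- with `v(p) = U_x·G + U_u·u₁` the third component of `Φ̃(p)`,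
the transformation law
`(v(p)·F_{u₁}(Φ̃(p)) − F(Φ̃(p)))·W(p) = X'(x)·U_u(x,u)·(u₁·G_{u₁}(p) − G(p))`
holds; in particular (where `X' ≠ 0`, `U_u ≠ 0`, `W(p) ≠ 0`) the condition
`u₁·G_{u₁} − G ≠ 0` is feedback-invariant. -/
theorem u1Hu1_minus_H_transformation_law
    (F G : ℝ × ℝ × ℝ → ℝ) (X : ℝ → ℝ) (U : ℝ × ℝ → ℝ)
    (hF : ContDiff ℝ (⊤ : ℕ∞) F) (hG : ContDiff ℝ (⊤ : ℕ∞) G)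
    (hX : ContDiff ℝ (⊤ : ℕ∞) X) (hU : ContDiff ℝ (⊤ : ℕ∞) U)
    (hX' : ∀ x, deriv X x ≠ 0) (hUu : ∀ q, Uu U q ≠ 0)
    (D : Set (ℝ × ℝ × ℝ)) (hD : IsOpen D)
    (hrel : Relates X U G F D) :
    ∀ p ∈ D,
      ((Ux U (p.1, p.2.1) * G p + Uu U (p.1, p.2.1) * p.2.2) * pd F du1 (Prol X U G p)
            - F (Prol X U G p)) * Wfun U G p
        = deriv X p.1 * Uu U (p.1, p.2.1) * (p.2.2 * pd G du1 p - G p) ∧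
      (Wfun U G p ≠ 0 →
        ((p.2.2 * pd G du1 p - G p ≠ 0) ↔
          ((Prol X U G p).2.2 * pd F du1 (Prol X U G p) - F (Prol X U G p) ≠ 0))) := by
  intro p hp
  have hderiv := hrel.pd_du1_mul_Wfun (hF.differentiable (by simp)) (hG.differentiable (by simp))
    hD hp
  have hval : deriv X p.1 * G p = F (Prol X U G p) := hrel p hp
  have hlaw : ((Ux U (p.1, p.2.1) * G p + Uu U (p.1, p.2.1) * p.2.2) * pd F du1 (Prol X U G p)
        - F (Prol X U G p)) * Wfun U G p
      = deriv X p.1 * Uu U (p.1, p.2.1) * (p.2.2 * pd G du1 p - G p) := by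
    rw [sub_mul, mul_assoc, hderiv, ← hval, Wfun]
    ring
  refine ⟨hlaw, fun hW => ?_⟩
  have hc : deriv X p.1 * Uu U (p.1, p.2.1) ≠ 0 := mul_ne_zero (hX' _) (hUu _)
  rw [← mul_ne_zero_iff_left hc, ← hlaw]
  exact mul_ne_zero_iff_right hW
end
end

section
/- Let F, G : ℝ³ → ℝ be smooth and suppose the feedback transformation (X,U) relates G to F on an open set D ⊆ ℝ³. Let p = (x,u,u₁) ∈ D be such that W(p) ≠ 0, G_{u₁}(p) ≠ 0 and u₁·G_{u₁}(p) − G(p) ≠ 0. Then J^F is defined at Φ̃(p), J^G is defined at p, and J^F(Φ̃(p)) = J^G(p). That is, J is a feedback differential invariant of order 2 (part 1 of Theorem 1: the first non-trivial feedback differential invariants appear in order 2 and are functions of the basic invariant J). -/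
noncomputable section

def Jinv (H : ℝ × ℝ × ℝ → ℝ) : ℝ × ℝ × ℝ → ℝ :=
  fun p => H p ^ 2 * pd (pd H du1) du1 p / ((p.2.2 * pd H du1 p - H p) * pd H du1 p ^ 2)

theorem contDiff_pd {H : ℝ × ℝ × ℝ → ℝ} (hH : ContDiff ℝ (⊤ : ℕ∞) H) (v : ℝ × ℝ × ℝ) :
    ContDiff ℝ (⊤ : ℕ∞) (pd H v) :=
  (hH.fderiv_right (m := (⊤ : ℕ∞)) (by simp)).clm_apply contDiff_const

/-- `∂H/∂u₁` is the ordinary derivative of `H` along the third coordinate line. -/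
theorem hasDerivAt_pd_du1 {H : ℝ × ℝ × ℝ → ℝ} (hH : ContDiff ℝ (⊤ : ℕ∞) H) (x u t : ℝ) :
    HasDerivAt (fun s => H (x, u, s)) (pd H du1 (x, u, t)) t := by
  have hline : HasDerivAt (fun s : ℝ => (x, u, s)) du1 t :=
    (hasDerivAt_const t x).prodMk ((hasDerivAt_const t u).prodMk (hasDerivAt_id t))
  exact ((hH.differentiable (by simp)) (x, u, t)).hasFDerivAt.comp_hasDerivAt t hline

/-- First and second order consequences of `c g(t) = f(a g(t) + b t)` near `t₀`. -/
theorem derivs_of_eventually_eq_comp {f f' f'' g g' g'' : ℝ → ℝ} {a b c t₀ : ℝ}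
    (hf : ∀ s, HasDerivAt f (f' s) s) (hf' : ∀ s, HasDerivAt f' (f'' s) s)
    (hg : ∀ t, HasDerivAt g (g' t) t) (hg' : ∀ t, HasDerivAt g' (g'' t) t)
    (h : ∀ᶠ t in nhds t₀, c * g t = f (a * g t + b * t)) :
    c * g' t₀ = f' (a * g t₀ + b * t₀) * (a * g' t₀ + b) ∧
    c * g'' t₀ = f'' (a * g t₀ + b * t₀) * (a * g' t₀ + b) ^ 2 +
      f' (a * g t₀ + b * t₀) * (a * g'' t₀) := by
  have hs (t : ℝ) : HasDerivAt (fun t => a * g t + b * t) (a * g' t + b) t := by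
    simpa using ((hg t).const_mul a).fun_add ((hasDerivAt_id t).const_mul b)
  have first : ∀ᶠ t in nhds t₀, c * g' t = f' (a * g t + b * t) * (a * g' t + b) := by
    filter_upwards [h.eventually_nhds] with t ht
    exact ((hg t).const_mul c).unique (((hf _).comp t (hs t)).congr_of_eventuallyEq ht)
  refine ⟨first.self_of_nhds, ?_⟩
  have hprod := ((hf' _).comp t₀ (hs t₀)).mul (((hg' t₀).const_mul a).add_const b)
  have hsecond := ((hg' t₀).const_mul c).unique (hprod.congr_of_eventuallyEq first)
  simp only [Function.comp_apply] at hsecond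
  linear_combination hsecond

/-- `J` is a feedback differential invariant of order 2: if `(X,U)`
relates `G` to `F` on an open set `D`, `p ∈ D`, `W(p) ≠ 0`, `G_{u₁}(p) ≠ 0` and
`u₁·G_{u₁}(p) − G(p) ≠ 0`, then `J^F` is defined at `Φ̃(p)` (its denominator does
not vanish), `J^G` is defined at `p`, and `J^F(Φ̃(p)) = J^G(p)`. -/
theorem J_is_feedback_invariant
    (F G : ℝ × ℝ × ℝ → ℝ) (X : ℝ → ℝ) (U : ℝ × ℝ → ℝ)
    (hF : ContDiff ℝ (⊤ : ℕ∞) F) (hG : ContDiff ℝ (⊤ : ℕ∞) G)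
    (hX : ContDiff ℝ (⊤ : ℕ∞) X) (hU : ContDiff ℝ (⊤ : ℕ∞) U)
    (hX' : ∀ x, deriv X x ≠ 0) (hUu : ∀ q, Uu U q ≠ 0)
    (D : Set (ℝ × ℝ × ℝ)) (hD : IsOpen D)
    (hrel : Relates X U G F D)
    (p : ℝ × ℝ × ℝ) (hp : p ∈ D) (hW : Wfun U G p ≠ 0)
    (hG1 : pd G du1 p ≠ 0) (hG2 : p.2.2 * pd G du1 p - G p ≠ 0) :
    pd F du1 (Prol X U G p) ≠ 0 ∧
    (Prol X U G p).2.2 * pd F du1 (Prol X U G p) - F (Prol X U G p) ≠ 0 ∧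
    Jinv F (Prol X U G p) = Jinv G p := by
  obtain ⟨x, u, t⟩ := p
  have hb := hUu (x, u)
  have hc := hX' x
  have hline : Filter.Tendsto (fun s : ℝ => (x, u, s)) (nhds t) (nhds (x, u, t)) :=
    Continuous.tendsto (by fun_prop) t
  have hnear := (hline.eventually (hD.mem_nhds hp)).mono fun s hs => hrel (x, u, s) hs
  obtain ⟨h1, h2⟩ := derivs_of_eventually_eq_comp
    (a := Ux U (x, u)) (b := Uu U (x, u)) (c := deriv X x)
    (hasDerivAt_pd_du1 hF (X x) (U (x, u)))
    (hasDerivAt_pd_du1 (contDiff_pd hF du1) (X x) (U (x, u)))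
    (hasDerivAt_pd_du1 hG x u) (hasDerivAt_pd_du1 (contDiff_pd hG du1) x u) hnear
  have h0 := hrel (x, u, t) hp
  simp only [Wfun] at hW
  simp only [Jinv, Prol] at h0 hG2 ⊢
  rw [← h0]
  set a := Ux U (x, u)
  set b := Uu U (x, u)
  set c := deriv X x
  set g := G (x, u, t)
  set g₁ := pd G du1 (x, u, t)
  set g₂ := pd (pd G du1) du1 (x, u, t)
  set f₁ := pd F du1 (X x, U (x, u), a * g + b * t)
  set f₂ := pd (pd F du1) du1 (X x, U (x, u), a * g + b * t)
  obtain ⟨W, hWdef⟩ : ∃ W, W = a * g₁ + b := ⟨_, rfl⟩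
  rw [← hWdef] at hW h1 h2
  have hf₁ : f₁ = c * g₁ / W := by rw [eq_div_iff hW, h1]
  have hf₂ : f₂ = c * b * g₂ / W ^ 3 := by
    rw [eq_div_iff (pow_ne_zero 3 hW)]
    linear_combination -W * h2 + a * g₂ * h1 + c * g₂ * hWdef
  have hden : (a * g + b * t) * f₁ - c * g = c * b * (t * g₁ - g) / W := by
    rw [hf₁, eq_div_iff hW, sub_mul, mul_assoc, div_mul_cancel₀ _ hW, hWdef]
    ring
  refine ⟨?_, ?_, ?_⟩
  · rw [hf₁]
    exact div_ne_zero (mul_ne_zero hc hG1) hW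
  · rw [hden]
    exact div_ne_zero (mul_ne_zero (mul_ne_zero hc hb) hG2) hW
  · rw [hden, hf₁, hf₂]
    field_simp
end
end

section
/- Let F, G : ℝ³ → ℝ be smooth and suppose the feedback transformation (X,U) relates G to F on an open set D ⊆ ℝ³. Let p = (x,u,u₁) ∈ D with W(p) ≠ 0 and G_{u₁}(p) ≠ 0. Then the derivative of Φ̃ at p maps the vector ∇₂^G(p) to ∇₂^F(Φ̃(p)), i.e. DΦ̃(p)·∇₂^G(p) = ∇₂^F(Φ̃(p)). That is, ∇₂ is a feedback invariant derivation. -/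
noncomputable section

/-- The feedback invariant derivation `∇₂^H = (0, 0, H/H_{u₁})`. -/
def nabla2 (H : ℝ × ℝ × ℝ → ℝ) : ℝ × ℝ × ℝ → ℝ × ℝ × ℝ := fun p =>
  (0, 0, H p / pd H du1 p)

/-- The coordinate line through `(x, u, t)` in the direction `∂/∂u₁`. -/
theorem hasDerivAt_u1_line (x u t : ℝ) : HasDerivAt (fun s : ℝ => (x, u, s)) du1 t :=
  (hasDerivAt_const t x).prodMk ((hasDerivAt_const t u).prodMk (hasDerivAt_id t))

theorem hasDerivAt_comp_u1_line {E : Type*} [NormedAddCommGroup E] [NormedSpace ℝ E]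
    {H : ℝ × ℝ × ℝ → E} {x u t : ℝ} (hH : DifferentiableAt ℝ H (x, u, t)) :
    HasDerivAt (fun s : ℝ => H (x, u, s)) (fderiv ℝ H (x, u, t) du1) t :=
  hH.hasFDerivAt.comp_hasDerivAt t (hasDerivAt_u1_line x u t)

theorem differentiable_prol {X : ℝ → ℝ} {U : ℝ × ℝ → ℝ} {G : ℝ × ℝ × ℝ → ℝ}
    (hX : Differentiable ℝ X) (hU : ContDiff ℝ 2 U) (hG : Differentiable ℝ G) :
    Differentiable ℝ (Prol X U G) := by
  have hdU : Differentiable ℝ (fderiv ℝ U) :=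
    (hU.fderiv_right (m := 1) (by norm_num)).differentiable (by norm_num)
  have hU1 : Differentiable ℝ U := hU.differentiable (by norm_num)
  unfold Prol Ux Uu
  fun_prop

/-- The prolongation maps `∂/∂u₁` to `W · ∂/∂u₁`. -/
theorem fderiv_prol_du1 {X : ℝ → ℝ} {U : ℝ × ℝ → ℝ} {G : ℝ × ℝ × ℝ → ℝ}
    (hX : Differentiable ℝ X) (hU : ContDiff ℝ 2 U) (hG : Differentiable ℝ G)
    (p : ℝ × ℝ × ℝ) :
    fderiv ℝ (Prol X U G) p du1 = Wfun U G p • du1 := by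
  obtain ⟨x, u, t⟩ := p
  refine (hasDerivAt_comp_u1_line (differentiable_prol hX hU hG _)).unique ?_
  have h : HasDerivAt (fun s : ℝ => Ux U (x, u) * G (x, u, s) + Uu U (x, u) * s)
      (Wfun U G (x, u, t)) t := by
    simpa [Wfun, pd] using
      ((hasDerivAt_comp_u1_line (hG (x, u, t))).const_mul (Ux U (x, u))).fun_add
        ((hasDerivAt_id t).const_mul (Uu U (x, u)))
  simpa [Prol, du1] using
    (hasDerivAt_const t (X x)).prodMk ((hasDerivAt_const t (U (x, u))).prodMk h)

/-- The `u₁`-derivative of the relation between `G` and `F`. -/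
theorem Relates.deriv_mul_pd_du1 {F G : ℝ × ℝ × ℝ → ℝ} {X : ℝ → ℝ} {U : ℝ × ℝ → ℝ}
    {D : Set (ℝ × ℝ × ℝ)} (hrel : Relates X U G F D) (hD : IsOpen D)
    (hF : Differentiable ℝ F) (hX : Differentiable ℝ X) (hU : ContDiff ℝ 2 U)
    (hG : Differentiable ℝ G) {p : ℝ × ℝ × ℝ} (hp : p ∈ D) :
    deriv X p.1 * pd G du1 p = Wfun U G p * pd F du1 (Prol X U G p) := by
  have hW := fderiv_prol_du1 hX hU hG p
  obtain ⟨x, u, t⟩ := p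
  have hl := (hasDerivAt_comp_u1_line (hG (x, u, t))).const_mul (deriv X x)
  have hr := hasDerivAt_comp_u1_line
    ((hF _).comp (x, u, t) (differentiable_prol hX hU hG (x, u, t)))
  rw [fderiv_comp _ (hF _) (differentiable_prol hX hU hG _), ContinuousLinearMap.comp_apply, hW,
    map_smul, smul_eq_mul] at hr
  have hev : ∀ᶠ s in nhds t, (x, u, s) ∈ D :=
    (hasDerivAt_u1_line x u t).continuousAt.eventually (hD.mem_nhds hp)
  exact hl.unique (hr.congr_of_eventuallyEq (hev.mono fun s hs => hrel _ hs))

/-- `∇₂` is a feedback invariant derivation: if `(X,U)` relates `G`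
to `F` on an open set `D`, `p ∈ D`, `W(p) ≠ 0` and `G_{u₁}(p) ≠ 0`, then
`DΦ̃(p)·∇₂^G(p) = ∇₂^F(Φ̃(p))`. -/
theorem nabla2_feedback_invariant
    (F G : ℝ × ℝ × ℝ → ℝ) (X : ℝ → ℝ) (U : ℝ × ℝ → ℝ)
    (hF : ContDiff ℝ (⊤ : ℕ∞) F) (hG : ContDiff ℝ (⊤ : ℕ∞) G)
    (hX : ContDiff ℝ (⊤ : ℕ∞) X) (hU : ContDiff ℝ (⊤ : ℕ∞) U)
    (hX' : ∀ x, deriv X x ≠ 0) (hUu : ∀ q, Uu U q ≠ 0)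
    (D : Set (ℝ × ℝ × ℝ)) (hD : IsOpen D)
    (hrel : Relates X U G F D)
    (p : ℝ × ℝ × ℝ) (hp : p ∈ D) (hW : Wfun U G p ≠ 0) (hG1 : pd G du1 p ≠ 0) :
    fderiv ℝ (Prol X U G) p (nabla2 G p) = nabla2 F (Prol X U G p) := by
  have hF1 : Differentiable ℝ F := hF.differentiable (by simp)
  have hG1d : Differentiable ℝ G := hG.differentiable (by simp)
  have hX1 : Differentiable ℝ X := hX.differentiable (by simp)
  have hU2 : ContDiff ℝ 2 U := contDiff_infty.mp hU 2
  have hd := hrel.deriv_mul_pd_du1 hD hF1 hX1 hU2 hG1d hp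
  have hv : F (Prol X U G p) = deriv X p.1 * G p := (hrel p hp).symm
  have hFne : pd F du1 (Prol X U G p) ≠ 0 :=
    right_ne_zero_of_mul (hd ▸ mul_ne_zero (hX' p.1) hG1)
  have hn (H : ℝ × ℝ × ℝ → ℝ) (q : ℝ × ℝ × ℝ) : nabla2 H q = (H q / pd H du1 q) • du1 := by
    simp [nabla2, du1]
  rw [hn, hn, map_smul, fderiv_prol_du1 hX1 hU2 hG1d, smul_smul, hv]
  congr 1
  rw [div_mul_eq_mul_div, div_eq_div_iff hG1 hFne]
  linear_combination -G p * hd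
end
end

section
/- Let F, G : ℝ³ → ℝ be smooth and suppose the feedback transformation (X,U) relates G to F on an open set D ⊆ ℝ³. Let p = (x,u,u₁) ∈ D with W(p) ≠ 0 and G_{u₁}(p) ≠ 0. Then the derivative of Φ̃ at p maps the vector ∇₁^G(p) to ∇₁^F(Φ̃(p)), i.e. DΦ̃(p)·∇₁^G(p) = ∇₁^F(Φ̃(p)). That is, ∇₁ is a feedback invariant derivation. -/
noncomputable section

/-- The feedback invariant derivation
`∇₁^H = (0, (u₁·H_{u₁} − H)/H_{u₁}, (H − u₁·H_{u₁})·H_u/H_{u₁}²)`. -/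
def nabla1 (H : ℝ × ℝ × ℝ → ℝ) : ℝ × ℝ × ℝ → ℝ × ℝ × ℝ := fun p =>
  (0, (p.2.2 * pd H du1 p - H p) / pd H du1 p,
    (H p - p.2.2 * pd H du1 p) * pd H du p / pd H du1 p ^ 2)

lemma contDiff_Ux {U : ℝ × ℝ → ℝ} (hU : ContDiff ℝ (⊤ : ℕ∞) U) :
    ContDiff ℝ (⊤ : ℕ∞) (Ux U) :=
  (hU.fderiv_right (m := (⊤ : ℕ∞)) le_rfl).clm_apply contDiff_const

lemma contDiff_Uu {U : ℝ × ℝ → ℝ} (hU : ContDiff ℝ (⊤ : ℕ∞) U) :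
    ContDiff ℝ (⊤ : ℕ∞) (Uu U) :=
  (hU.fderiv_right (m := (⊤ : ℕ∞)) le_rfl).clm_apply contDiff_const

lemma contDiff_Prol {X : ℝ → ℝ} {U : ℝ × ℝ → ℝ} {G : ℝ × ℝ × ℝ → ℝ}
    (hX : ContDiff ℝ (⊤ : ℕ∞) X) (hU : ContDiff ℝ (⊤ : ℕ∞) U)
    (hG : ContDiff ℝ (⊤ : ℕ∞) G) : ContDiff ℝ (⊤ : ℕ∞) (Prol X U G) := by
  have hUx := contDiff_Ux hU
  have hUu := contDiff_Uu hU
  unfold Prol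
  fun_prop

/-- A linear functional on `ℝ³` applied to a vector tangent to the fibres `x = const`. -/
lemma fderiv_apply_vertical (H : ℝ × ℝ × ℝ → ℝ) (p : ℝ × ℝ × ℝ) (a b : ℝ) :
    fderiv ℝ H p (0, a, b) = a * pd H du p + b * pd H du1 p := by
  have h : ((0, a, b) : ℝ × ℝ × ℝ) = a • du + b • du1 := by simp [du, du1]
  rw [h, map_add, map_smul, map_smul, smul_eq_mul, smul_eq_mul, pd, pd]

/-- `∇₁^H` annihilates `H`. -/
lemma fderiv_nabla1_self (H : ℝ × ℝ × ℝ → ℝ) (p : ℝ × ℝ × ℝ) (hH : pd H du1 p ≠ 0) :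
    fderiv ℝ H p (nabla1 H p) = 0 := by
  rw [nabla1, fderiv_apply_vertical]
  field_simp
  ring

/-- The projection `(x, u, u₁) ↦ (x, u)` is its own derivative. -/
lemma hasFDerivAt_fst_pair (p : ℝ × ℝ × ℝ) :
    HasFDerivAt (fun q : ℝ × ℝ × ℝ => (q.1, q.2.1))
      ((ContinuousLinearMap.fst ℝ ℝ (ℝ × ℝ)).prod
        ((ContinuousLinearMap.fst ℝ ℝ ℝ).comp (ContinuousLinearMap.snd ℝ ℝ (ℝ × ℝ)))) p :=
  hasFDerivAt_fst.prodMk (hasFDerivAt_snd (p := p)).fst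

section Prolongation

variable {X : ℝ → ℝ} {U : ℝ × ℝ → ℝ} {F G : ℝ × ℝ × ℝ → ℝ}

/-- The first two components of the derivative of the prolongation along the fibres of `x`. -/
lemma fderiv_Prol_vertical (hX : ContDiff ℝ (⊤ : ℕ∞) X) (hU : ContDiff ℝ (⊤ : ℕ∞) U)
    (hG : ContDiff ℝ (⊤ : ℕ∞) G) (p : ℝ × ℝ × ℝ) (a b : ℝ) :
    ∃ c, fderiv ℝ (Prol X U G) p (0, a, b) = (0, a * Uu U (p.1, p.2.1), c) := by
  have hP : HasFDerivAt (Prol X U G) (fderiv ℝ (Prol X U G) p) p :=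
    ((contDiff_Prol hX hU hG).differentiable (by simp) p).hasFDerivAt
  have h₁ := hP.fst.unique
    ((hX.differentiable (by simp) p.1).hasFDerivAt.comp p hasFDerivAt_fst)
  have hUq := (hU.differentiable (by simp) (p.1, p.2.1)).hasFDerivAt.comp p
    (hasFDerivAt_fst_pair p)
  have h₂ := hP.snd.fst.unique hUq
  refine ⟨(fderiv ℝ (Prol X U G) p (0, a, b)).2.2, Prod.ext ?_ (Prod.ext ?_ rfl)⟩
  · simpa using DFunLike.congr_fun h₁ (0, a, b)
  · have h : ((0, a) : ℝ × ℝ) = a • (0, 1) := by simp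
    have h₃ := DFunLike.congr_fun h₂ (0, a, b)
    simp only [ContinuousLinearMap.comp_apply, ContinuousLinearMap.prod_apply,
      ContinuousLinearMap.coe_fst', ContinuousLinearMap.coe_snd'] at h₃
    rw [h₃, h, map_smul, smul_eq_mul, Uu]

lemma fderiv_Prol_du1 (hX : ContDiff ℝ (⊤ : ℕ∞) X) (hU : ContDiff ℝ (⊤ : ℕ∞) U)
    (hG : ContDiff ℝ (⊤ : ℕ∞) G) (p : ℝ × ℝ × ℝ) :
    fderiv ℝ (Prol X U G) p du1 = (0, 0, Wfun U G p) := by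
  have hP : HasFDerivAt (Prol X U G) (fderiv ℝ (Prol X U G) p) p :=
    ((contDiff_Prol hX hU hG).differentiable (by simp) p).hasFDerivAt
  have hq := hasFDerivAt_fst_pair p
  have hUx := ((contDiff_Ux hU).differentiable (by simp) (p.1, p.2.1)).hasFDerivAt.comp p hq
  have hUu := ((contDiff_Uu hU).differentiable (by simp) (p.1, p.2.1)).hasFDerivAt.comp p hq
  have h := hP.snd.snd.unique
    ((hUx.mul (hG.differentiable (by simp) p).hasFDerivAt).add (hUu.mul (hasFDerivAt_snd (p := p)).snd))
  obtain ⟨c, hc⟩ := fderiv_Prol_vertical hX hU hG p 0 1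
  have h₃ := DFunLike.congr_fun h du1
  rw [du1] at h₃ ⊢
  simp [hc] at h₃
  rw [hc, h₃]
  simp [Wfun, pd, du1, Prod.mk_zero_zero]

/-- The differentiated relation between `G` and `F` along the fibres of `x`. -/
lemma Relates.fderiv_vertical (hF : ContDiff ℝ (⊤ : ℕ∞) F) (hG : ContDiff ℝ (⊤ : ℕ∞) G)
    (hX : ContDiff ℝ (⊤ : ℕ∞) X) (hU : ContDiff ℝ (⊤ : ℕ∞) U) {D : Set (ℝ × ℝ × ℝ)}
    (hD : IsOpen D) (hrel : Relates X U G F D) {p : ℝ × ℝ × ℝ} (hp : p ∈ D) (a b : ℝ) :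
    deriv X p.1 * fderiv ℝ G p (0, a, b) =
      fderiv ℝ F (Prol X U G p) (fderiv ℝ (Prol X U G) p (0, a, b)) := by
  have hX₁ : DifferentiableAt ℝ (deriv X) p.1 :=
    ((contDiff_infty_iff_deriv.mp hX).2.differentiable (by simp)) p.1
  have hL := (hX₁.hasFDerivAt.comp p hasFDerivAt_fst).mul
    (hG.differentiable (by simp) p).hasFDerivAt
  have hR := (hF.differentiable (by simp) (Prol X U G p)).hasFDerivAt.comp p
    ((contDiff_Prol hX hU hG).differentiable (by simp) p).hasFDerivAt
  have h := hL.unique (hR.congr_of_eventuallyEq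
    (Filter.eventuallyEq_of_mem (hD.mem_nhds hp) hrel))
  simpa using DFunLike.congr_fun h (0, a, b)

end Prolongation

/-- `∇₁` is a feedback invariant derivation: if `(X,U)` relates `G`
to `F` on an open set `D`, `p ∈ D`, `W(p) ≠ 0` and `G_{u₁}(p) ≠ 0`, then
`DΦ̃(p)·∇₁^G(p) = ∇₁^F(Φ̃(p))`. -/
theorem nabla1_feedback_invariant
    (F G : ℝ × ℝ × ℝ → ℝ) (X : ℝ → ℝ) (U : ℝ × ℝ → ℝ)
    (hF : ContDiff ℝ (⊤ : ℕ∞) F) (hG : ContDiff ℝ (⊤ : ℕ∞) G)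
    (hX : ContDiff ℝ (⊤ : ℕ∞) X) (hU : ContDiff ℝ (⊤ : ℕ∞) U)
    (hX' : ∀ x, deriv X x ≠ 0) (hUu : ∀ q, Uu U q ≠ 0)
    (D : Set (ℝ × ℝ × ℝ)) (hD : IsOpen D)
    (hrel : Relates X U G F D)
    (p : ℝ × ℝ × ℝ) (hp : p ∈ D) (hW : Wfun U G p ≠ 0) (hG1 : pd G du1 p ≠ 0) :
    fderiv ℝ (Prol X U G) p (nabla1 G p) = nabla1 F (Prol X U G p) := by
  obtain ⟨c, hc⟩ := fderiv_Prol_vertical hX hU hG p (nabla1 G p).2.1 (nabla1 G p).2.2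
  have hv : ((0, (nabla1 G p).2.1, (nabla1 G p).2.2) : ℝ × ℝ × ℝ) = nabla1 G p := rfl
  have hann := hrel.fderiv_vertical hF hG hX hU hD hp (nabla1 G p).2.1 (nabla1 G p).2.2
  rw [hc, hv, fderiv_nabla1_self G p hG1, mul_zero, fderiv_apply_vertical] at hann
  have hone := hrel.fderiv_vertical hF hG hX hU hD hp 0 1
  rw [← du1, fderiv_Prol_du1 hX hU hG, fderiv_apply_vertical, zero_mul, zero_add] at hone
  change deriv X p.1 * pd G du1 p = Wfun U G p * pd F du1 (Prol X U G p) at hone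
  have hF1 : pd F du1 (Prol X U G p) ≠ 0 := fun h =>
    mul_ne_zero (hX' p.1) hG1 (by rw [hone, h, mul_zero])
  have hFG : deriv X p.1 * G p = F (Prol X U G p) := hrel p hp
  have hmid : (nabla1 G p).2.1 * Uu U (p.1, p.2.1) = (nabla1 F (Prol X U G p)).2.1 := by
    have hFW : F (Prol X U G p) * pd G du1 p = G p * Wfun U G p * pd F du1 (Prol X U G p) := by
      rw [← hFG]
      linear_combination G p * hone
    have hthird : (Prol X U G p).2.2 =
      Ux U (p.1, p.2.1) * G p + Uu U (p.1, p.2.1) * p.2.2 := rfl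
    simp only [nabla1]
    rw [hthird]
    rw [Wfun] at hFW
    field_simp
    linear_combination hFW
  rw [← hv, hc]
  refine Prod.ext rfl (Prod.ext hmid ?_)
  rw [hmid] at hann
  simp only [nabla1] at hann ⊢
  field_simp at hann ⊢
  linear_combination -hann
end
end
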